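/- Let m ≥ 1 be a natural number and ν, u real numbers. Define, for each natural number n, Q_n = ∑_{k=0}^{⌊n/m⌋} (−1)^k · (ν)_{n−(m−1)k} · (2u)^{n−mk} / (k!·(n−mk)!), where (ν)_j = ν(ν+1)⋯(ν+j−1) is the ascending Pochhammer symbol with (ν)_0 = 1. Then for every real t with 2|u||t| + |t|^m < 1 (so that 1 − 2ut + t^m > 0), the series ∑_{n=0}^{∞} Q_n·t^n converges absolutely and its sum equals (1 − 2ut + t^m)^{−ν}, the real power of the positive base 1 − 2ut + t^m. -/

import Mathlib

open Real Finset

/-- The type 2 Humbert polynomial value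
`Q_{n,m}^ν(u) = ∑_{k=0}^{⌊n/m⌋} (−1)^k (ν)_{n−(m−1)k} (2u)^{n−mk} / (k!(n−mk)!)`. -/
noncomputable def humbert2 (m : ℕ) (ν u : ℝ) (n : ℕ) : ℝ :=
  ∑ k ∈ Finset.range (n / m + 1),
    (-1 : ℝ) ^ k * (ascPochhammer ℝ (n - (m - 1) * k)).eval ν *
      (2 * u) ^ (n - m * k) / (k.factorial * (n - m * k).factorial)

theorem ringChoose_eq_ascPochhammer_eval_div_factorial (ν : ℝ) (n : ℕ) :
    Ring.choose (ν + n - 1) n = (ascPochhammer ℝ n).eval ν / n.factorial := by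
  have hn : (n.factorial : ℝ) ≠ 0 := by positivity
  have h := Ring.factorial_nsmul_multichoose_eq_ascPochhammer ν n
  rw [Polynomial.ascPochhammer_smeval_eq_eval, nsmul_eq_mul] at h
  rw [Ring.choose, show ν + n - 1 - n + 1 = ν by ring, eq_div_iff hn, mul_comm, h]

/-- The binomial series `∑ (ν)_n / n! xⁿ = (1 - x)^{-ν}`. -/
theorem hasSum_ascPochhammer_div_factorial_mul_pow (ν : ℝ) {x : ℝ} (hx : |x| < 1) :
    HasSum (fun n : ℕ => (ascPochhammer ℝ n).eval ν / n.factorial * x ^ n)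
      ((1 - x) ^ (-ν)) := by
  have hball : x ∈ Metric.eball (0 : ℝ) 1 := by
    simpa [enorm_eq_nnnorm, ← NNReal.coe_lt_coe] using hx
  have h := (Real.one_div_one_sub_rpow_hasFPowerSeriesOnBall_zero ν).hasSum hball
  have hpos : 0 ≤ 1 - x := by linarith [le_abs_self x]
  simpa [ringChoose_eq_ascPochhammer_eval_div_factorial, Real.rpow_neg hpos, mul_comm] using h

theorem sum_antidiagonal_pow_mul_pow_div_factorial (c x y : ℝ) (n : ℕ) :
    ∑ p ∈ antidiagonal n,
        c * x ^ p.1 * y ^ p.2 / (p.1.factorial * p.2.factorial) =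
      c / n.factorial * (x + y) ^ n := by
  rw [(Commute.all x y).add_pow', Finset.mul_sum]
  refine Finset.sum_congr rfl fun p hp => ?_
  obtain rfl := mem_antidiagonal.mp hp
  have h : ((p.1 + p.2).choose p.1 : ℝ) * p.1.factorial * p.2.factorial =
      (p.1 + p.2).factorial := by
    rw [Nat.choose_symm_add]
    exact_mod_cast Nat.add_choose_mul_factorial_mul_factorial p.1 p.2
  have h₁ : ((p.1 + p.2).choose p.1 : ℝ) ≠ 0 := by
    exact_mod_cast (Nat.choose_pos (Nat.le_add_right _ _)).ne'
  rw [← h, nsmul_eq_mul]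
  field_simp

/-- The binomial series of `(1 - x - y)^{-ν}` as an absolutely convergent double series. -/
theorem hasSum_prod_ascPochhammer_mul_pow_mul_pow (ν : ℝ) {x y : ℝ} (h : |x| + |y| < 1) :
    HasSum
      (fun p : ℕ × ℕ => (ascPochhammer ℝ (p.1 + p.2)).eval ν * x ^ p.1 * y ^ p.2 /
        (p.1.factorial * p.2.factorial))
      ((1 - (x + y)) ^ (-ν)) := by
  set F : ℕ × ℕ → ℝ := fun p => (ascPochhammer ℝ (p.1 + p.2)).eval ν * x ^ p.1 * y ^ p.2 /
    (p.1.factorial * p.2.factorial) with hF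
  have hfiber (n : ℕ) : ∑ p ∈ antidiagonal n, F p =
      (ascPochhammer ℝ n).eval ν / n.factorial * (x + y) ^ n := by
    rw [← sum_antidiagonal_pow_mul_pow_div_factorial]
    refine Finset.sum_congr rfl fun p hp => ?_
    rw [hF, ← mem_antidiagonal.mp hp]
  have hfiber_abs (n : ℕ) : ∑ p ∈ antidiagonal n, |F p| =
      |(ascPochhammer ℝ n).eval ν / n.factorial * (|x| + |y|) ^ n| := by
    rw [abs_mul, abs_div, Nat.abs_cast, abs_of_nonneg (by positivity : 0 ≤ (|x| + |y|) ^ n),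
      ← sum_antidiagonal_pow_mul_pow_div_factorial]
    refine Finset.sum_congr rfl fun p hp => ?_
    rw [hF, ← mem_antidiagonal.mp hp]
    simp [abs_mul, abs_div]
  let e := Finset.HasAntidiagonal.sigmaAntidiagonalEquivProd (A := ℕ)
  have habs : Summable fun q : Σ n : ℕ, antidiagonal n => |F (e q)| := by
    rw [summable_sigma_of_nonneg fun _ => abs_nonneg _]
    refine ⟨fun n => (hasSum_fintype _).summable, ?_⟩
    have hs := (hasSum_ascPochhammer_div_factorial_mul_pow ν
      (x := |x| + |y|) (by rwa [abs_of_nonneg (by positivity)])).summable.abs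
    refine hs.congr fun n => ?_
    rw [← hfiber_abs, tsum_fintype]
    exact (Finset.sum_coe_sort (antidiagonal n) fun p => |F p|).symm
  have hsum : Summable fun q : Σ n : ℕ, antidiagonal n => F (e q) := habs.of_abs
  have hsigma := hsum.hasSum.sigma fun n => hasSum_fintype _
  have heq (n : ℕ) : ∑ p : antidiagonal n, F (e ⟨n, p⟩) =
      (ascPochhammer ℝ n).eval ν / n.factorial * (x + y) ^ n := by
    rw [← hfiber]
    exact Finset.sum_coe_sort (antidiagonal n) F
  simp only [heq] at hsigma
  rw [← e.hasSum_iff, ← hsigma.unique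
    (hasSum_ascPochhammer_div_factorial_mul_pow ν ((abs_add_le x y).trans_lt h))]
  exact hsum.hasSum

/-- Summing a double series along the lines `j + m * k = n`. -/
theorem HasSum.sum_range_div_add_one {F : ℕ × ℕ → ℝ} {a : ℝ} (hF : HasSum F a) {m : ℕ}
    (hm : 0 < m) :
    HasSum (fun n : ℕ => ∑ k ∈ range (n / m + 1), F (n - m * k, k)) a := by
  let G : ℕ × ℕ → ℝ := fun q => if m * q.2 ≤ q.1 then F (q.1 - m * q.2, q.2) else 0
  let i : ℕ × ℕ → ℕ × ℕ := fun p => (p.1 + m * p.2, p.2)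
  have hi : Function.Injective i := by
    rintro ⟨j, k⟩ ⟨j', k'⟩ h
    simp only [i, Prod.mk.injEq] at h
    obtain ⟨h, rfl⟩ := h
    simpa using h
  have hG : HasSum G a := by
    rw [← hi.hasSum_iff]
    · simpa [G, i, Function.comp_def] using hF
    · rintro ⟨n, k⟩ hnk
      refine if_neg fun hle => hnk ⟨(n - m * k, k), ?_⟩
      simp only [i, Prod.mk.injEq, and_true]
      exact Nat.sub_add_cancel hle
  refine hG.prod_fiberwise fun n => ?_
  have hmem (k : ℕ) : k ∈ range (n / m + 1) ↔ m * k ≤ n := by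
    rw [mem_range, Nat.lt_succ_iff, Nat.le_div_iff_mul_le hm, mul_comm]
  have hsum : ∑ k ∈ range (n / m + 1), F (n - m * k, k) =
      ∑ k ∈ range (n / m + 1), G (n, k) :=
    Finset.sum_congr rfl fun k hk => (if_pos ((hmem k).mp hk)).symm
  rw [hsum]
  exact hasSum_sum_of_ne_finset_zero fun k hk => if_neg fun hle => hk ((hmem k).mpr hle)

theorem humbert2_mul_pow {m : ℕ} (hm : 1 ≤ m) (ν u t : ℝ) (n : ℕ) :
    humbert2 m ν u n * t ^ n =
      ∑ k ∈ range (n / m + 1), (ascPochhammer ℝ (n - m * k + k)).eval ν *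
        (2 * u * t) ^ (n - m * k) * (-t ^ m) ^ k / ((n - m * k).factorial * k.factorial) := by
  rw [humbert2, Finset.sum_mul]
  refine Finset.sum_congr rfl fun k hk => ?_
  have hle : m * k ≤ n := by
    rw [mem_range, Nat.lt_succ_iff, Nat.le_div_iff_mul_le hm] at hk
    rwa [mul_comm]
  have hkm : k ≤ m * k := Nat.le_mul_of_pos_left k hm
  have hidx : n - (m - 1) * k = n - m * k + k := by
    rw [Nat.sub_mul, one_mul]
    omega
  have hpow : t ^ n = t ^ (n - m * k) * (t ^ m) ^ k := by
    rw [← pow_mul, ← pow_add, Nat.sub_add_cancel hle]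
  rw [hidx, hpow, neg_pow (t ^ m), mul_pow (2 * u) t]
  ring

/-- Generating function of the type 2 Humbert polynomials: for `2|u||t| + |t|^m < 1`,
the series `∑ Q_{n,m}^ν(u) tⁿ` converges absolutely to `(1 − 2ut + t^m)^{−ν}`. -/
theorem humbert2_generating_function (m : ℕ) (hm : 1 ≤ m) (ν u : ℝ) (t : ℝ)
    (ht : 2 * |u| * |t| + |t| ^ m < 1) :
    (Summable fun n : ℕ => |humbert2 m ν u n * t ^ n|) ∧
      ∑' n : ℕ, humbert2 m ν u n * t ^ n =
        (1 - 2 * u * t + t ^ m) ^ (-ν) := by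
  have hxy : |2 * u * t| + |-t ^ m| < 1 := by simpa [abs_mul] using ht
  have h : HasSum (fun n : ℕ => humbert2 m ν u n * t ^ n)
      ((1 - 2 * u * t + t ^ m) ^ (-ν)) := by
    simp only [humbert2_mul_pow hm]
    rw [show 1 - 2 * u * t + t ^ m = 1 - (2 * u * t + -t ^ m) by ring]
    exact (hasSum_prod_ascPochhammer_mul_pow_mul_pow ν hxy).sum_range_div_add_one hm
  exact ⟨h.summable.abs, h.tsum_eq⟩
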